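/- Let P be a set, F = F(P) the free abelian monoid over P, and H ⊆ F a submonoid such that the inclusion H ↪ F is a divisor homomorphism, with class group G = q(F)/q(H). Assume a function f: 𝔛(H) → P is given with q = f(q)F ∩ H for every q ∈ 𝔛(H), set e(q) = min{h(f(q)) : h ∈ H, h(f(q)) > 0}, let ∂: H → F(𝔛(H)) be defined by ∂(h)(q) = h(f(q))/e(q), let C(∂) be the quotient of the group of finitely supported functions 𝔛(H) → ℤ by the subgroup generated by ∂(H), let Ḡ = {[x] : x ∈ q(F) with e(q) dividing x(f(q)) for all q ∈ 𝔛(H)} ⊆ G, and let δ: Ḡ → C(∂) be the surjection induced by x ↦ (q ↦ x(f(q))/e(q)). If r(G) = r(C(∂)) < ∞, then every p ∈ P equals f(q) for some q ∈ 𝔛(H), and δ: Ḡ → C(∂) is a group isomorphism. -/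

import Mathlib

/-- The canonical embedding of the free abelian monoid `F(P)` into its quotient group
`q(F)`, i.e. of `P →₀ ℕ` into `P →₀ ℤ`. -/
noncomputable def toIntF {P : Type*} : (P →₀ ℕ) →+ (P →₀ ℤ) :=
  Finsupp.mapRange.addMonoidHom (Nat.castAddMonoidHom ℤ)

/-- The inclusion `H ↪ F(P)` is a divisor homomorphism. -/
def IsDivHomF {P : Type*} (H : AddSubmonoid (P →₀ ℕ)) : Prop :=
  ∀ a ∈ H, ∀ b ∈ H, a ≤ b → b - a ∈ H

/-- The inclusion `H ↪ F(P)` is cofinal. -/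
def IsCofinalF {P : Type*} (H : AddSubmonoid (P →₀ ℕ)) : Prop :=
  ∀ x : P →₀ ℕ, ∃ h ∈ H, x ≤ h

/-- The inclusion `H ↪ F(P)` is a divisor theory: a divisor homomorphism such that every
`p ∈ P` is the pointwise infimum of a finite nonempty subset of `H`. -/
def IsDivTheoryF {P : Type*} (H : AddSubmonoid (P →₀ ℕ)) : Prop :=
  IsDivHomF H ∧ ∀ p : P, ∃ (X : Finset (P →₀ ℕ)) (hX : X.Nonempty),
    (X : Set (P →₀ ℕ)) ⊆ (H : Set (P →₀ ℕ)) ∧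
      ∀ q : P, X.inf' hX (fun h => h q) = Finsupp.single p 1 q

/-- The quotient group `q(H)` of `H`, as a subgroup of `q(F) = (P →₀ ℤ)`. -/
noncomputable def qHsub {P : Type*} (H : AddSubmonoid (P →₀ ℕ)) : AddSubgroup (P →₀ ℤ) :=
  AddSubgroup.closure (⇑toIntF '' (H : Set (P →₀ ℕ)))

/-- The class group `G = q(F)/q(H)` of the inclusion `H ↪ F(P)`. -/
abbrev ClassGrp {P : Type*} (H : AddSubmonoid (P →₀ ℕ)) : Type _ :=
  (P →₀ ℤ) ⧸ qHsub H

/-- The canonical projection `q(F) → G`, `x ↦ [x]`. -/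
noncomputable def clsOf {P : Type*} (H : AddSubmonoid (P →₀ ℕ)) : (P →₀ ℤ) →+ ClassGrp H :=
  QuotientAddGroup.mk' (qHsub H)

/-- The set `G_P = {[p] : p ∈ P}` of classes containing prime divisors. -/
def GPset {P : Type*} (H : AddSubmonoid (P →₀ ℕ)) : Set (ClassGrp H) :=
  {g | ∃ p : P, g = clsOf H (Finsupp.single p 1)}

/-- An `s`-ideal of `H`: a subset `𝔞 ⊆ H` with `𝔞 + H ⊆ 𝔞`. -/
def IsSIdeal {P : Type*} (H : AddSubmonoid (P →₀ ℕ)) (a : Set (P →₀ ℕ)) : Prop :=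
  a ⊆ (H : Set (P →₀ ℕ)) ∧ ∀ x ∈ a, ∀ h ∈ H, x + h ∈ a

/-- A prime `s`-ideal of `H`. -/
def IsPrimeSIdeal {P : Type*} (H : AddSubmonoid (P →₀ ℕ)) (a : Set (P →₀ ℕ)) : Prop :=
  IsSIdeal H a ∧ a ≠ (H : Set (P →₀ ℕ)) ∧
    ∀ x ∈ H, ∀ y ∈ H, x + y ∈ a → x ∈ a ∨ y ∈ a

/-- `𝔛(H)`: the set of minimal nonempty prime `s`-ideals of `H`. -/
def XH {P : Type*} (H : AddSubmonoid (P →₀ ℕ)) : Set (Set (P →₀ ℕ)) :=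
  {q | q.Nonempty ∧ IsPrimeSIdeal H q ∧
    ∀ q' : Set (P →₀ ℕ), q'.Nonempty → IsPrimeSIdeal H q' → q' ⊆ q → q' = q}

/-- For `p ∈ P`, the set `pF ∩ H = {h ∈ H : h(p) ≥ 1}`. -/
def pIdeal {P : Type*} (H : AddSubmonoid (P →₀ ℕ)) (p : P) : Set (P →₀ ℕ) :=
  {h | h ∈ H ∧ 1 ≤ h p}

/-- The image set `∂(H)` inside the free abelian group over `𝔛(H)`. -/
def delSet {P : Type*} (H : AddSubmonoid (P →₀ ℕ)) (f : ↥(XH H) → P) (e : ↥(XH H) → ℕ) :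
    Set (↥(XH H) →₀ ℤ) :=
  {y | ∃ h ∈ H, ∀ q : ↥(XH H), y q = ((h : P →₀ ℕ) (f q) / e q : ℕ)}

/-- The class group `C(∂)` of the divisor theory `∂`: the quotient of the free abelian
group over `𝔛(H)` by the subgroup generated by `∂(H)`. -/
abbrev Cdel {P : Type*} (H : AddSubmonoid (P →₀ ℕ)) (f : ↥(XH H) → P) (e : ↥(XH H) → ℕ) :
    Type _ :=
  (↥(XH H) →₀ ℤ) ⧸ AddSubgroup.closure (delSet H f e)

/-- The subgroup of `q(F)` of elements `x` with `e(q) ∣ x(f(q))` for all `q ∈ 𝔛(H)`. -/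
noncomputable def divSub {P : Type*} (H : AddSubmonoid (P →₀ ℕ)) (f : ↥(XH H) → P) (e : ↥(XH H) → ℕ) :
    AddSubgroup (P →₀ ℤ) where
  carrier := {x | ∀ q : ↥(XH H), (e q : ℤ) ∣ x (f q)}
  zero_mem' := fun q => by simp
  add_mem' := by
    intro x y hx hy q
    rw [Finsupp.add_apply]
    exact dvd_add (hx q) (hy q)
  neg_mem' := by
    intro x hx q
    rw [Finsupp.neg_apply]
    exact dvd_neg.mpr (hx q)

/-- The subgroup `Ḡ = {[x] : x ∈ q(F), e(q) ∣ x(f(q)) for all q} ⊆ G`. -/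
noncomputable def GbarSub {P : Type*} (H : AddSubmonoid (P →₀ ℕ)) (f : ↥(XH H) → P)
    (e : ↥(XH H) → ℕ) : AddSubgroup (ClassGrp H) :=
  (divSub H f e).map (clsOf H)

/-- The torsion-free rank `r(A) = dim_ℚ (A ⊗ ℚ)` of an abelian group `A`. -/
noncomputable def tfRank (A : Type*) [AddCommGroup A] :=
  Module.rank ℚ (TensorProduct ℤ ℚ A)

theorem toIntF_app {P : Type*} (h : P →₀ ℕ) (p : P) : toIntF h p = (h p : ℤ) := by
  simp [toIntF]

theorem qH_of_mem {P : Type*} {H : AddSubmonoid (P →₀ ℕ)} {h : P →₀ ℕ} (hh : h ∈ H) :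
    toIntF h ∈ qHsub H := AddSubgroup.subset_closure ⟨h, hh, rfl⟩

theorem qH_exists {P : Type*} {H : AddSubmonoid (P →₀ ℕ)} {x : P →₀ ℤ} (hx : x ∈ qHsub H) :
    ∃ a ∈ H, ∃ b ∈ H, x = toIntF a - toIntF b := by
  induction hx using AddSubgroup.closure_induction with
  | mem x hx =>
    obtain ⟨a, ha, rfl⟩ := hx
    exact ⟨a, ha, 0, H.zero_mem, by simp⟩
  | zero => exact ⟨0, H.zero_mem, 0, H.zero_mem, by simp⟩
  | add x y _ _ hx hy =>
    obtain ⟨a, ha, b, hb, rfl⟩ := hx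
    obtain ⟨c, hc, d, hd, rfl⟩ := hy
    exact ⟨a + c, H.add_mem ha hc, b + d, H.add_mem hb hd, by simp only [map_add]; abel⟩
  | neg x _ hx =>
    obtain ⟨a, ha, b, hb, rfl⟩ := hx
    exact ⟨b, hb, a, ha, by abel⟩

theorem qH_nonneg {P : Type*} {H : AddSubmonoid (P →₀ ℕ)} (hdiv : IsDivHomF H)
    {x : P →₀ ℤ} (hx : x ∈ qHsub H) (h0 : 0 ≤ x) : ∃ h ∈ H, toIntF h = x := by
  obtain ⟨a, ha, b, hb, rfl⟩ := qH_exists hx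
  have hle : b ≤ a := by
    intro p
    have := h0 p
    simp [toIntF_app] at this
    exact this
  refine ⟨a - b, hdiv b hb a ha hle, ?_⟩
  ext p
  have := hle p
  simp [toIntF_app]
  omega

/-- The data making a prime `J` a discrete valuation prime. -/
def GoodJ {P : Type*} (H : AddSubmonoid (P →₀ ℕ)) (J : Set (P →₀ ℕ)) : Prop :=
  ∃ z : P →₀ ℤ, (∀ h ∈ H, z ≤ toIntF h → h ∈ J) ∧
    (∃ u ∈ H, u ∉ J ∧ ∃ w ∈ H, toIntF w = z + toIntF u) ∧
    ∀ d ∈ H, ∃ m : ℕ, ∃ s ∈ H, s ∉ J ∧ toIntF d = m • z + toIntF s ∧ (d ∈ J → 1 ≤ m)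

theorem zero_notMem_prime {P : Type*} {H : AddSubmonoid (P →₀ ℕ)} {J : Set (P →₀ ℕ)}
    (hJ : IsPrimeSIdeal H J) : (0 : P →₀ ℕ) ∉ J := by
  intro h0
  apply hJ.2.1
  apply Set.Subset.antisymm hJ.1.1
  intro h hh
  simpa using hJ.1.2 0 h0 h hh

theorem nsmul_notMem_prime {P : Type*} {H : AddSubmonoid (P →₀ ℕ)} {J : Set (P →₀ ℕ)}
    (hJ : IsPrimeSIdeal H J) {x : P →₀ ℕ} (hx : x ∈ H) (hxJ : x ∉ J) (n : ℕ) : n • x ∉ J := by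
  induction n with
  | zero => simpa using zero_notMem_prime hJ
  | succ n ih =>
    intro h
    rw [succ_nsmul] at h
    rcases hJ.2.2 _ (H.nsmul_mem hx n) _ hx h with h | h
    · exact ih h
    · exact hxJ h

theorem good_min {P : Type*} {H : AddSubmonoid (P →₀ ℕ)} (hdiv : IsDivHomF H)
    {J : Set (P →₀ ℕ)} (hJ : IsPrimeSIdeal H J) (hne : J.Nonempty) (hg : GoodJ H J) :
    J ∈ XH H := by
  refine ⟨hne, hJ, ?_⟩
  intro q hqne hq hqJ
  apply Set.Subset.antisymm hqJ
  intro c hc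
  obtain ⟨d, hd⟩ := hqne
  have hdH := hq.1.1 hd
  have hcH := hJ.1.1 hc
  obtain ⟨z, -, ⟨u, huH, huJ, w, hwH, hw⟩, hdec⟩ := hg
  obtain ⟨m, s, hs, hsJ, hds, -⟩ := hdec d hdH
  obtain ⟨m', s', hs', -, hcs, hm'⟩ := hdec c hcH
  have hm := hm' hc
  obtain ⟨k, rfl⟩ := Nat.exists_eq_add_of_le' hm
  have ht : s + (m * k) • u ∉ q := by
    intro h
    rcases hq.2.2 _ hs _ (H.nsmul_mem huH _) h with h | h
    · exact hsJ (hqJ h)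
    · exact nsmul_notMem_prime hJ huH huJ _ (hqJ h)
  have hle : m • c + (s + (m * k) • u) = d + (m • s' + (m * k) • w) := by
    have : toIntF (m • c + (s + (m * k) • u)) = toIntF (d + (m • s' + (m * k) • w)) := by
      simp only [map_add, map_nsmul, hds, hcs, hw]
      module
    ext p
    have h2 := DFunLike.congr_fun this p
    rw [toIntF_app, toIntF_app] at h2
    exact_mod_cast h2
  have hin : m • c + (s + (m * k) • u) ∈ q := by
    rw [hle]
    exact hq.1.2 d hd _ (H.add_mem (H.nsmul_mem hs' _) (H.nsmul_mem hwH _))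
  by_contra hcq
  rcases hq.2.2 _ (H.nsmul_mem hcH _) _ (H.add_mem hs (H.nsmul_mem huH _)) hin with h | h
  · exact nsmul_notMem_prime hq hcH hcq _ h
  · exact ht h

theorem no_inf_desc {P : Type*} {z : P →₀ ℤ} (hz : ¬ z ≤ 0) (d : P →₀ ℕ) :
    ∃ N : ℕ, ∀ m : ℕ, m • z ≤ toIntF d → m ≤ N := by
  have : ∃ p, 0 < z p := by
    by_contra! h
    exact hz (fun p => by simpa using h p)
  obtain ⟨p, hp⟩ := this
  refine ⟨d p, fun m hm => ?_⟩
  have := hm p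
  simp [toIntF_app] at this
  have h2 : (m : ℤ) ≤ m * z p := by nlinarith
  omega

theorem good_exists {P : Type*} {H : AddSubmonoid (P →₀ ℕ)} (hdiv : IsDivHomF H)
    {z0 : P →₀ ℤ} (hz0 : z0 ∈ qHsub H) (hn0 : ¬ z0 ≤ 0) :
    ∃ J ∈ XH H, GoodJ H J ∧ ∀ h ∈ H, z0 ≤ toIntF h → h ∈ J := by
  classical
  let I : (P →₀ ℤ) → Set (P →₀ ℕ) := fun z => {h | h ∈ H ∧ z ≤ toIntF h}
  obtain ⟨a, ha, b, hb, hab⟩ := qH_exists hz0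
  have haI : a ∈ I z0 := ⟨ha, by
    rw [hab]; intro p; simp [toIntF_app]⟩
  let Fam : Set (Set (P →₀ ℕ)) := {K | I z0 ⊆ K ∧ ∃ z ∈ qHsub H, ¬ z ≤ 0 ∧ K = I z}
  have hfin : Fam.Finite := by
    apply ((Set.finite_Icc (0 : P →₀ ℕ) a).image (fun x => {h | h ∈ H ∧ x ≤ h})).subset
    rintro K ⟨hK, z, hz, hzn, rfl⟩
    refine ⟨z.mapRange Int.toNat rfl, ⟨zero_le, ?_⟩, ?_⟩
    · intro p
      have := (hK haI).2 p
      rw [toIntF_app] at this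
      simpa using this
    · ext h
      simp only [I, Set.mem_setOf_eq]
      apply and_congr_right
      intro _
      constructor
      · intro hh p
        have := hh p
        rw [toIntF_app]
        simpa using this
      · intro hh p
        have := hh p
        rw [toIntF_app] at this
        simpa using this
  obtain ⟨J, hJle, ⟨⟨hJ0, z, hz, hzn, rfl⟩, hmax⟩⟩ :=
    hfin.exists_le_maximal (show I z0 ∈ Fam from ⟨subset_rfl, z0, hz0, hn0, rfl⟩)
  have hprime : IsPrimeSIdeal H (I z) := by
    refine ⟨⟨fun h hh => hh.1, ?_⟩, ?_, ?_⟩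
    · intro x hx h hh
      refine ⟨H.add_mem hx.1 hh, hx.2.trans ?_⟩
      intro p
      simp [toIntF_app]
    · intro h
      have : (0 : P →₀ ℕ) ∈ I z := by rw [h]; exact H.zero_mem
      exact hzn (by simpa using this.2)
    · intro h hh k hk hhk
      by_contra! hcon
      have h1 : ¬ (z - toIntF k ≤ 0) := fun hle => hcon.2 ⟨hk, by simpa using hle⟩
      have hsub : I z ⊆ I (z - toIntF k) := by
        intro x hx
        refine ⟨hx.1, ?_⟩
        intro p
        have := hx.2 p
        simp only [toIntF_app, Finsupp.sub_apply] at this ⊢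
        omega
      have h2 : I (z - toIntF k) ⊆ I z := hmax
        ⟨hJ0.trans hsub, _, AddSubgroup.sub_mem _ hz (qH_of_mem hk), h1, rfl⟩ hsub
      apply hcon.1
      apply h2
      refine ⟨hh, ?_⟩
      have := hhk.2
      rw [map_add] at this
      simpa [sub_le_iff_le_add] using this
  have hstep : ∀ c ∈ I z, ∃ h ∈ H, toIntF h = toIntF c - z := by
    intro c hc
    exact qH_nonneg hdiv (AddSubgroup.sub_mem _ (qH_of_mem hc.1) hz) (by simpa using hc.2)
  have hdec : ∀ d ∈ H, ∃ m : ℕ, ∃ s ∈ H, s ∉ I z ∧ toIntF d = m • z + toIntF s ∧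
      (d ∈ I z → 1 ≤ m) := by
    intro d hd
    obtain ⟨N, hN⟩ := no_inf_desc hzn d
    have key : ∀ m : ℕ, (∃ s ∈ H, toIntF d = m • z + toIntF s) → m ≤ N := by
      rintro m ⟨s, -, hs⟩
      apply hN
      rw [hs]
      intro p
      simp [toIntF_app]
    have hex : ∃ m : ℕ, (∃ s ∈ H, toIntF d = m • z + toIntF s) ∧
        ¬ ∃ s ∈ H, toIntF d = (m + 1) • z + toIntF s := by
      by_contra! hcon
      have : ∀ m : ℕ, ∃ s ∈ H, toIntF d = m • z + toIntF s := by
        intro m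
        induction m with
        | zero => exact ⟨d, hd, by simp⟩
        | succ m ih => exact hcon m ih
      have := key _ (this (N + 1))
      omega
    obtain ⟨m, ⟨s, hs, hds⟩, hm⟩ := hex
    have hsJ : s ∉ I z := by
      intro hsI
      obtain ⟨h, hh, hhe⟩ := hstep s hsI
      apply hm
      refine ⟨h, hh, ?_⟩
      rw [hds, hhe]
      module
    refine ⟨m, s, hs, hsJ, hds, ?_⟩
    intro hdI
    by_contra hm0
    have : m = 0 := by omega
    subst this
    apply hsJ
    refine ⟨hs, ?_⟩
    have h3 : toIntF d = toIntF s := by simpa using hds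
    rw [← h3]; exact hdI.2
  have hgood : GoodJ H (I z) := by
    refine ⟨z, fun h hh hle => ⟨hh, hle⟩, ?_, hdec⟩
    obtain ⟨m, s, hs, hsJ, hds, hm⟩ := hdec a ha
    have hm1 := hm (hJ0 haI)
    -- choose the last element of the chain lying in the ideal
    by_contra! hcon
    have hall : ∀ k : ℕ, ∃ c ∈ I z, toIntF c = toIntF a - k • z := by
      intro k
      induction k with
      | zero => exact ⟨a, hJ0 haI, by simp⟩
      | succ k ih =>
        obtain ⟨c, hc, hce⟩ := ih
        obtain ⟨h, hh, hhe⟩ := hstep c hc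
        refine ⟨h, ?_, ?_⟩
        · by_contra hnot
          exact hcon h hh hnot c hc.1 (by rw [hhe]; abel)
        · rw [hhe, hce]; module
    obtain ⟨N, hN⟩ := no_inf_desc hzn a
    obtain ⟨c, hc, hce⟩ := hall (N + 1)
    have : N + 1 ≤ N := by
      apply hN
      have h4 : toIntF a = (N + 1) • z + toIntF c := by rw [hce]; abel
      rw [h4]
      intro p
      simp [toIntF_app]
    omega
  exact ⟨I z, good_min hdiv hprime ⟨a, hJ0 haI⟩ hgood, hgood, fun h hh hle => hJ0 ⟨hh, hle⟩⟩

/-- Value data at a good prime of the form `pF ∩ H`. -/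
theorem good_val {P : Type*} {H : AddSubmonoid (P →₀ ℕ)} {J : Set (P →₀ ℕ)} {p : P}
    (hJp : J = pIdeal H p) (hg : GoodJ H J) :
    ∃ z : P →₀ ℤ, 0 < z p ∧ (∃ u ∈ H, u ∉ J ∧ ∃ w ∈ H, toIntF w = z + toIntF u ∧
      (w p : ℤ) = z p) ∧
    ∀ d ∈ H, ∃ m : ℕ, ∃ s ∈ H, s ∉ J ∧ toIntF d = m • z + toIntF s ∧ (d p : ℤ) = m * z p := by
  have hnot : ∀ s ∈ H, s ∉ J → s p = 0 := by
    intro s hs hsJ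
    by_contra h
    exact hsJ (by rw [hJp]; exact ⟨hs, by omega⟩)
  obtain ⟨z, hz, ⟨u, hu, huJ, w, hw, hwe⟩, hdec⟩ := hg
  have hwz : (w p : ℤ) = z p := by
    have := DFunLike.congr_fun hwe p
    simpa [toIntF_app, hnot u hu huJ] using this
  have hwJ : w ∈ J := by
    apply hz w hw
    rw [hwe]
    intro x
    simp [toIntF_app]
  rw [hJp] at hwJ
  refine ⟨z, ?_, ⟨u, hu, huJ, w, hw, hwe, hwz⟩, ?_⟩
  · have := hwJ.2
    omega
  · intro d hd
    obtain ⟨m, s, hs, hsJ, hds, -⟩ := hdec d hd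
    refine ⟨m, s, hs, hsJ, hds, ?_⟩
    have := DFunLike.congr_fun hds p
    simpa [toIntF_app, hnot s hs hsJ] using this

theorem le_of_good {P : Type*} {H : AddSubmonoid (P →₀ ℕ)} (hdiv : IsDivHomF H)
    (f : ↥(XH H) → P) (hf : ∀ q : ↥(XH H), (q : Set (P →₀ ℕ)) = pIdeal H (f q))
    {a b : P →₀ ℕ} (ha : a ∈ H) (hb : b ∈ H)
    (hab : ∀ q : ↥(XH H), GoodJ H q → a (f q) ≤ b (f q)) : a ≤ b := by
  by_contra hcon
  have hn : ¬ (toIntF a - toIntF b ≤ 0) := by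
    intro h
    apply hcon
    intro p
    have := h p
    simp [toIntF_app] at this
    exact this
  obtain ⟨J, hJX, hg, hJ⟩ := good_exists hdiv
    (AddSubgroup.sub_mem _ (qH_of_mem ha) (qH_of_mem hb)) hn
  have hle := hab ⟨J, hJX⟩ hg
  have hJp := hf ⟨J, hJX⟩
  generalize f ⟨J, hJX⟩ = p at hle hJp
  obtain ⟨z, hzp, ⟨u, hu, huJ, w, hw, hwe, -⟩, hdec⟩ := good_val hJp hg
  obtain ⟨m, s, hs, hsJ, hds, hm⟩ := hdec a ha
  obtain ⟨m', s', hs', hsJ', hds', hm'⟩ := hdec b hb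
  have hmm : m ≤ m' := by
    have h1 : (m : ℤ) * z p ≤ m' * z p := by rw [← hm, ← hm']; exact_mod_cast hle
    have := le_of_mul_le_mul_right h1 hzp
    exact_mod_cast this
  obtain ⟨k, rfl⟩ := Nat.exists_eq_add_of_le hmm
  have hprime := hJX.2.1
  have hin : s + k • u ∈ J := by
    apply hJ _ (H.add_mem hs (H.nsmul_mem hu _))
    have : toIntF (s + k • u) = toIntF a - toIntF b + toIntF (s' + k • w) := by
      simp only [map_add, map_nsmul, hds, hds', hwe]
      module
    rw [this]
    intro x
    simp only [toIntF_app, Finsupp.add_apply, Finsupp.sub_apply]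
    omega
  rcases hprime.2.2 _ hs _ (H.nsmul_mem hu _) hin with h | h
  · exact hsJ h
  · exact nsmul_notMem_prime hprime hu huJ _ h

theorem all_good {P : Type*} {H : AddSubmonoid (P →₀ ℕ)} (hdiv : IsDivHomF H)
    (f : ↥(XH H) → P) (hf : ∀ q : ↥(XH H), (q : Set (P →₀ ℕ)) = pIdeal H (f q))
    (q : ↥(XH H)) : GoodJ H q := by
  classical
  by_contra hbad
  have hq := q.2.2.1
  have hex : ∀ p : P, ∃ g ∈ H, g ∉ (q : Set (P →₀ ℕ)) ∧
      ((∃ J : ↥(XH H), GoodJ H J ∧ f J = p) → 1 ≤ g p) := by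
    intro p
    by_cases h : ∃ J : ↥(XH H), GoodJ H J ∧ f J = p
    · obtain ⟨J, hJ, rfl⟩ := h
      have : ¬ (J : Set (P →₀ ℕ)) ⊆ q := by
        intro hsub
        have := q.2.2.2 J J.2.1 J.2.2.1 hsub
        exact hbad (this ▸ hJ)
      obtain ⟨g, hgJ, hgq⟩ := Set.not_subset.1 this
      rw [hf J] at hgJ
      exact ⟨g, hgJ.1, hgq, fun _ => hgJ.2⟩
    · exact ⟨0, H.zero_mem, zero_notMem_prime hq, fun h' => absurd h' h⟩
  choose g hgH hgq hg1 using hex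
  obtain ⟨d, hd⟩ := q.2.1
  have hdH := hq.1.1 hd
  have hsum : ∀ T : Finset P, (∑ p ∈ T, d p • g p) ∈ H ∧ (∑ p ∈ T, d p • g p) ∉ (q : Set _) := by
    intro T
    induction T using Finset.induction_on with
    | empty => exact ⟨by simp, by simpa using zero_notMem_prime hq⟩
    | insert p T hp ih =>
      rw [Finset.sum_insert hp]
      refine ⟨H.add_mem (H.nsmul_mem (hgH p) _) ih.1, fun h => ?_⟩
      rcases hq.2.2 _ (H.nsmul_mem (hgH p) _) _ ih.1 h with h | h
      · exact nsmul_notMem_prime hq (hgH p) (hgq p) _ h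
      · exact ih.2 h
  obtain ⟨hsH, hsq⟩ := hsum d.support
  have hle : d ≤ ∑ p ∈ d.support, d p • g p := by
    apply le_of_good hdiv f hf hdH hsH
    intro J hJ
    by_cases h0 : d (f J) = 0
    · rw [h0]; exact Nat.zero_le _
    · rw [Finsupp.finsetSum_apply]
      have h1 := Finset.single_le_sum (f := fun p => (d p • g p) (f J))
        (fun _ _ => Nat.zero_le _) (Finsupp.mem_support_iff.2 h0)
      have h2 := hg1 (f J) ⟨J, hJ, rfl⟩
      refine le_trans ?_ h1
      simp only [Finsupp.smul_apply, smul_eq_mul]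
      exact Nat.le_mul_of_pos_right _ h2
  apply hsq
  have := hq.1.2 d hd _ (hdiv d hdH _ hsH hle)
  rwa [add_tsub_cancel_of_le hle] at this

theorem e_dvd {P : Type*} {H : AddSubmonoid (P →₀ ℕ)} {J : Set (P →₀ ℕ)} {p : P}
    (hJp : J = pIdeal H p) (hg : GoodJ H J) {h : P →₀ ℕ} (hh : h ∈ H) :
    sInf {n : ℕ | 0 < n ∧ ∃ h ∈ H, (h : P →₀ ℕ) p = n} ∣ h p := by
  obtain ⟨z, hzp, ⟨u, hu, huJ, w, hw, hwe, hwz⟩, hdec⟩ := good_val hJp hg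
  set S := {n : ℕ | 0 < n ∧ ∃ h ∈ H, (h : P →₀ ℕ) p = n} with hS
  have hwS : w p ∈ S := ⟨by omega, w, hw, rfl⟩
  have hdv : ∀ d ∈ H, w p ∣ d p := by
    intro d hd
    obtain ⟨m, -, -, -, -, hm⟩ := hdec d hd
    rw [← hwz] at hm
    exact ⟨m, by rw [mul_comm]; exact_mod_cast hm⟩
  have : sInf S = w p := by
    apply le_antisymm (Nat.sInf_le hwS)
    obtain ⟨h0, d, hd, hde⟩ := Nat.sInf_mem ⟨_, hwS⟩
    rw [← hde] at h0 ⊢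
    exact Nat.le_of_dvd h0 (hdv d hd)
  rw [this]
  exact hdv h hh

theorem qH_eq_zero {P : Type*} {H : AddSubmonoid (P →₀ ℕ)} (hdiv : IsDivHomF H)
    (f : ↥(XH H) → P) (hf : ∀ q : ↥(XH H), (q : Set (P →₀ ℕ)) = pIdeal H (f q))
    {x : P →₀ ℤ} (hx : x ∈ qHsub H) (h0 : ∀ q, x (f q) = 0) : x = 0 := by
  obtain ⟨a, ha, b, hb, rfl⟩ := qH_exists hx
  have hab : ∀ q, a (f q) = b (f q) := by
    intro q
    have := h0 q
    simp [toIntF_app] at this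
    omega
  have : a = b := le_antisymm (le_of_good hdiv f hf ha hb fun q _ => (hab q).le)
    (le_of_good hdiv f hf hb ha fun q _ => (hab q).ge)
  simp [this]

open TensorProduct in
theorem torsion_of_rank.{u} {A C : Type u} [AddCommGroup A] [AddCommGroup C]
    (B : AddSubgroup A) (δ : B →+ C) (hs : Function.Surjective δ)
    (hrank : tfRank A = tfRank C) (hfin : tfRank A < Cardinal.aleph0)
    (g : B) (hg : δ g = 0) : ∃ n : ℤ, n ≠ 0 ∧ n • g = 0 := by
  unfold tfRank at hrank hfin
  let i : B →ₗ[ℤ] A := B.subtype.toIntLinearMap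
  let d : B →ₗ[ℤ] C := δ.toIntLinearMap
  have hi : Function.Injective (i.baseChange ℚ) := by
    have := Module.Flat.lTensor_preserves_injective_linearMap (M := ℚ) i Subtype.val_injective
    exact this
  have hd : Function.Surjective (d.baseChange ℚ) := LinearMap.lTensor_surjective ℚ hs
  have hA : Module.Finite ℚ (TensorProduct ℤ ℚ A) := Module.rank_lt_aleph0_iff.1 hfin
  have hB : Module.Finite ℚ (TensorProduct ℤ ℚ B) := Module.Finite.of_injective _ hi
  have hC : Module.Finite ℚ (TensorProduct ℤ ℚ C) := Module.Finite.of_surjective _ hd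
  have h1 := LinearMap.finrank_le_finrank_of_injective hi
  have h2 : Module.finrank ℚ (TensorProduct ℤ ℚ A) = Module.finrank ℚ (TensorProduct ℤ ℚ C) := by
    simp only [Module.finrank, hrank]
  have h3 := LinearMap.finrank_range_add_finrank_ker (d.baseChange ℚ)
  rw [LinearMap.range_eq_top.2 hd, finrank_top] at h3
  have h4 : LinearMap.ker (d.baseChange ℚ) = ⊥ := by
    apply Submodule.finrank_eq_zero.1
    omega
  have h5 : (1 : ℚ) ⊗ₜ[ℤ] g = 0 := by
    apply LinearMap.ker_eq_bot.1 h4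
    have : d g = 0 := hg
    simp [this]
  by_contra! hcon
  let j : ℤ →ₗ[ℤ] B := LinearMap.toSpanSingleton ℤ B g
  have hj : Function.Injective j := by
    rw [injective_iff_map_eq_zero]
    intro n hn
    by_contra hn0
    exact hcon n hn0 (by simpa [j] using hn)
  have h6 := Module.Flat.lTensor_preserves_injective_linearMap (M := ℚ) j hj
  have h7 : (1 : ℚ) ⊗ₜ[ℤ] (1 : ℤ) = 0 := by
    apply h6
    simp [j, h5]
  have h8 := congrArg (TensorProduct.rid ℤ ℚ) h7
  simp at h8

/-- With `δ : Ḡ → C(∂)` the surjection induced by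
`x ↦ (q ↦ x(f(q))/e(q))`, if `r(G) = r(C(∂)) < ∞`, then every `p ∈ P` equals `f(q)` for
some `q ∈ 𝔛(H)`, and `δ` is a group isomorphism. -/
theorem delta_bijective_of_rank_eq {P : Type*} (H : AddSubmonoid (P →₀ ℕ))
    (hdiv : IsDivHomF H) (f : ↥(XH H) → P)
    (hf : ∀ q : ↥(XH H), (q : Set (P →₀ ℕ)) = pIdeal H (f q))
    (e : ↥(XH H) → ℕ)
    (he : ∀ q : ↥(XH H), e q = sInf {n : ℕ | 0 < n ∧ ∃ h ∈ H, (h : P →₀ ℕ) (f q) = n})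
    (δ : ↥(GbarSub H f e) →+ Cdel H f e)
    (hδsurj : Function.Surjective δ)
    (hδ : ∀ (x : P →₀ ℤ) (hx : x ∈ divSub H f e) (y : ↥(XH H) →₀ ℤ),
      (∀ q : ↥(XH H), y q * e q = x (f q)) →
      δ ⟨clsOf H x, AddSubgroup.mem_map_of_mem (clsOf H) hx⟩ =
        QuotientAddGroup.mk' (AddSubgroup.closure (delSet H f e)) y)
    (hrank : tfRank (ClassGrp H) = tfRank (Cdel H f e))
    (hfin : tfRank (ClassGrp H) < Cardinal.aleph0) :
    (∀ p : P, ∃ q : ↥(XH H), f q = p) ∧ Function.Bijective δ := by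
  classical
  have hfinj : Function.Injective f := by
    intro q q' h
    apply Subtype.ext
    rw [hf q, hf q', h]
  have hdv : ∀ h ∈ H, ∀ q, e q ∣ (h : P →₀ ℕ) (f q) := by
    intro h hh q
    rw [he q]
    exact e_dvd (hf q) (all_good hdiv f hf q) hh
  have hsurj : ∀ p : P, ∃ q : ↥(XH H), f q = p := by
    intro p
    by_contra! hp
    have hx0 : ∀ q, (Finsupp.single p (1 : ℤ)) (f q) = 0 := fun q =>
      Finsupp.single_eq_of_ne (hp q)
    have hx : Finsupp.single p (1 : ℤ) ∈ divSub H f e := fun q => by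
      rw [hx0 q]; exact dvd_zero _
    have h1 := hδ _ hx 0 (fun q => by rw [hx0 q]; simp)
    rw [map_zero] at h1
    obtain ⟨n, hn, hng⟩ := torsion_of_rank _ δ hδsurj hrank hfin _ h1
    have h2 : clsOf H (n • Finsupp.single p (1 : ℤ)) = 0 := by
      rw [map_zsmul]
      exact congrArg Subtype.val hng
    have h3 : n • Finsupp.single p (1 : ℤ) ∈ qHsub H := (QuotientAddGroup.eq_zero_iff _).1 h2
    have h4 := qH_eq_zero hdiv f hf h3 (fun q => by rw [Finsupp.smul_apply, hx0 q, smul_zero])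
    have h5 := DFunLike.congr_fun h4 p
    simp at h5
    exact hn h5
  refine ⟨hsurj, ?_, hδsurj⟩
  rw [injective_iff_map_eq_zero]
  rintro ⟨_, x, hx, rfl⟩ h0
  have hsf : (Function.support fun q => x (f q) / (e q : ℤ)).Finite := by
    apply (x.finite_support.preimage hfinj.injOn).subset
    intro q hq hq0
    apply hq
    change x (f q) = 0 at hq0
    simp [hq0]
  let y : ↥(XH H) →₀ ℤ := Finsupp.ofSupportFinite _ hsf
  have hy : ∀ q, y q * e q = x (f q) := fun q => Int.ediv_mul_cancel (hx q)
  have h1 := (hδ x hx y hy).symm.trans h0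
  have h2 : y ∈ AddSubgroup.closure (delSet H f e) := (QuotientAddGroup.eq_zero_iff _).1 h1
  have h3 : ∀ y ∈ AddSubgroup.closure (delSet H f e),
      ∃ w ∈ qHsub H, ∀ q, y q * e q = w (f q) := by
    intro y hy
    induction hy using AddSubgroup.closure_induction with
    | mem y hy =>
      obtain ⟨h, hh, hy⟩ := hy
      refine ⟨toIntF h, qH_of_mem hh, fun q => ?_⟩
      rw [hy q, toIntF_app]
      exact_mod_cast Nat.div_mul_cancel (hdv h hh q)
    | zero => exact ⟨0, AddSubgroup.zero_mem _, by simp⟩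
    | add a b _ _ iha ihb =>
      obtain ⟨v, hv, hv'⟩ := iha
      obtain ⟨w, hw, hw'⟩ := ihb
      exact ⟨v + w, AddSubgroup.add_mem _ hv hw, fun q => by
        rw [Finsupp.add_apply, Finsupp.add_apply, add_mul, hv', hw']⟩
    | neg a _ iha =>
      obtain ⟨v, hv, hv'⟩ := iha
      exact ⟨-v, AddSubgroup.neg_mem _ hv, fun q => by
        rw [Finsupp.neg_apply, Finsupp.neg_apply, neg_mul, hv']⟩
  obtain ⟨w, hw, hwy⟩ := h3 y h2
  have hxw : x = w := by
    ext p
    obtain ⟨q, rfl⟩ := hsurj p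
    rw [← hy, hwy]
  apply Subtype.ext
  exact (QuotientAddGroup.eq_zero_iff _).2 (hxw ▸ hw)
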